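/- In the lattice (Z^8, Q) of signature (1,7), the product g of the seven pairwise-commuting reflections about H-E_1-E_2-E_7, H-E_3-E_4-E_7, H-E_5-E_6-E_7, E_1-E_2, E_3-E_4, E_5-E_6, and 2H-E_1-...-E_6 fixes K = -3H + E_1 + ... + E_7 and acts by negation on the orthogonal complement of K (i.e., g is the homological action of the Geiser involution). -/

import Mathlib

/-- In `(ℤ^8, Q)` of signature `(1,7)`, the product `g` of the seven
pairwise-commuting reflections about `H-E₁-E₂-E₇`, `H-E₃-E₄-E₇`, `H-E₅-E₆-E₇`, `E₁-E₂`,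
`E₃-E₄`, `E₅-E₆`, `2H-E₁-⋯-E₆` fixes `K = -3H + E₁ + ⋯ + E₇` and acts by negation on the
orthogonal complement of `K` (i.e. `g` is the homological action of the Geiser involution). -/
theorem stmt_19
    (Q : (Fin 8 → ℤ) → (Fin 8 → ℤ) → ℤ)
    (hQ : ∀ x y, Q x y = ∑ i : Fin 8, (if (i : ℕ) = 0 then 1 else -1) * x i * y i)
    (Ref : (Fin 8 → ℤ) → (Fin 8 → ℤ) → (Fin 8 → ℤ))
    (hRef : ∀ v w, Ref v w = w + Q v w • v)
    (g : (Fin 8 → ℤ) → (Fin 8 → ℤ))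
    (hg : ∀ w, g w = Ref ![1,-1,-1,0,0,0,0,-1] (Ref ![1,0,0,-1,-1,0,0,-1]
        (Ref ![1,0,0,0,0,-1,-1,-1] (Ref ![0,1,-1,0,0,0,0,0] (Ref ![0,0,0,1,-1,0,0,0]
        (Ref ![0,0,0,0,0,1,-1,0] (Ref ![2,-1,-1,-1,-1,-1,-1,0] w)))))))
    (K : Fin 8 → ℤ) (hK : K = ![-3,1,1,1,1,1,1,1]) :
    g K = K ∧ ∀ x : Fin 8 → ℤ, Q x K = 0 → g x = -x := by
  have hadd : ∀ v w u (c : ℤ), Q v (w + c • u) = Q v w + c * Q v u := by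
    intro v w u c
    simp only [hQ, Fin.sum_univ_eight, Pi.add_apply, Pi.smul_apply, smul_eq_mul]
    ring
  have hg' : ∀ w, g w = w + Q ![2,-1,-1,-1,-1,-1,-1,0] w • ![2,-1,-1,-1,-1,-1,-1,0]
      + Q ![0,0,0,0,0,1,-1,0] w • ![0,0,0,0,0,1,-1,0]
      + Q ![0,0,0,1,-1,0,0,0] w • ![0,0,0,1,-1,0,0,0]
      + Q ![0,1,-1,0,0,0,0,0] w • ![0,1,-1,0,0,0,0,0]
      + Q ![1,0,0,0,0,-1,-1,-1] w • ![1,0,0,0,0,-1,-1,-1]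
      + Q ![1,0,0,-1,-1,0,0,-1] w • ![1,0,0,-1,-1,0,0,-1]
      + Q ![1,-1,-1,0,0,0,0,-1] w • ![1,-1,-1,0,0,0,0,-1] := by
    intro w
    have e : ∀ a b, (∑ i : Fin 8, (if (i : ℕ) = 0 then 1 else -1) * a i * b i) = 0 →
        Q a b = 0 := fun a b h => (hQ a b).trans h
    rw [hg]
    simp only [hRef, hadd]
    rw [e ![0,0,0,0,0,1,-1,0] ![2,-1,-1,-1,-1,-1,-1,0] (by decide),
      e ![0,0,0,1,-1,0,0,0] ![2,-1,-1,-1,-1,-1,-1,0] (by decide),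
      e ![0,1,-1,0,0,0,0,0] ![2,-1,-1,-1,-1,-1,-1,0] (by decide),
      e ![1,0,0,0,0,-1,-1,-1] ![2,-1,-1,-1,-1,-1,-1,0] (by decide),
      e ![1,0,0,-1,-1,0,0,-1] ![2,-1,-1,-1,-1,-1,-1,0] (by decide),
      e ![1,-1,-1,0,0,0,0,-1] ![2,-1,-1,-1,-1,-1,-1,0] (by decide),
      e ![0,0,0,1,-1,0,0,0] ![0,0,0,0,0,1,-1,0] (by decide),
      e ![0,1,-1,0,0,0,0,0] ![0,0,0,0,0,1,-1,0] (by decide),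
      e ![1,0,0,0,0,-1,-1,-1] ![0,0,0,0,0,1,-1,0] (by decide),
      e ![1,0,0,-1,-1,0,0,-1] ![0,0,0,0,0,1,-1,0] (by decide),
      e ![1,-1,-1,0,0,0,0,-1] ![0,0,0,0,0,1,-1,0] (by decide),
      e ![0,1,-1,0,0,0,0,0] ![0,0,0,1,-1,0,0,0] (by decide),
      e ![1,0,0,0,0,-1,-1,-1] ![0,0,0,1,-1,0,0,0] (by decide),
      e ![1,0,0,-1,-1,0,0,-1] ![0,0,0,1,-1,0,0,0] (by decide),
      e ![1,-1,-1,0,0,0,0,-1] ![0,0,0,1,-1,0,0,0] (by decide),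
      e ![1,0,0,0,0,-1,-1,-1] ![0,1,-1,0,0,0,0,0] (by decide),
      e ![1,0,0,-1,-1,0,0,-1] ![0,1,-1,0,0,0,0,0] (by decide),
      e ![1,-1,-1,0,0,0,0,-1] ![0,1,-1,0,0,0,0,0] (by decide),
      e ![1,0,0,-1,-1,0,0,-1] ![1,0,0,0,0,-1,-1,-1] (by decide),
      e ![1,-1,-1,0,0,0,0,-1] ![1,0,0,0,0,-1,-1,-1] (by decide),
      e ![1,-1,-1,0,0,0,0,-1] ![1,0,0,-1,-1,0,0,-1] (by decide)]
    simp only [mul_zero, add_zero]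
  subst hK
  constructor
  · rw [hg']
    simp only [hQ]
    decide
  · intro x hx
    rw [hg']
    simp [hQ, Fin.sum_univ_eight] at hx
    ext i
    simp only [Pi.add_apply, Pi.smul_apply, Pi.neg_apply]
    fin_cases i <;> simp [hQ, Fin.sum_univ_eight] <;> linarith
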